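/- arXiv:math/0312083 — 3 statements merged into one kernel-verified Lean document; each statement's English description precedes it below -/
import Mathlib

section
/- Let m > n ≥ 1, let A be a complex m×n matrix, and let b ∈ ℂ^m, c ∈ ℂ^n, u ∈ ℂ^n, v, w ∈ ℂ^m. Then the set of points z = (x, s, y, ẋ, ṡ, ẏ, μ) ∈ ℂ^n × ℂ^m × ℂ^m × ℂ^n × ℂ^m × ℂ^m × ℂ with μ ≠ 0, Φ^{A,b,c,u,v,w}(z) = 0, and the derivative DΦ^{A,b,c,u,v,w}(z) invertible, has cardinality at most 2^{2m}. -/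
/-- The space of variables `(x, s, y, ẋ, ṡ, ẏ, μ)` of the central-path system. -/
abbrev CPVars (K : Type) (m n : ℕ) :=
  (Fin n → K) × (Fin m → K) × (Fin m → K) × (Fin n → K) × (Fin m → K) × (Fin m → K) × K

/-- The complexified polynomial map `Φ^{A,b,c,u,v,w}` of the central-path system. -/
noncomputable def cpPhi {m n : ℕ} (A : Matrix (Fin m) (Fin n) ℂ)
    (b : Fin m → ℂ) (c : Fin n → ℂ) (u : Fin n → ℂ) (v w : Fin m → ℂ)
    (z : CPVars ℂ m n) :
    (Fin m → ℂ) × (Fin n → ℂ) × (Fin m → ℂ) × (Fin m → ℂ) × (Fin n → ℂ) × (Fin m → ℂ) × ℂ :=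
  (A.mulVec z.1 - z.2.1 - b,
   A.transpose.mulVec z.2.2.1 - c,
   (fun i => z.2.1 i * z.2.2.1 i - z.2.2.2.2.2.2),
   A.mulVec z.2.2.2.1 - z.2.2.2.2.1,
   A.transpose.mulVec z.2.2.2.2.2.1,
   (fun i => z.2.2.2.2.1 i * z.2.2.1 i + z.2.1 i * z.2.2.2.2.2.1 i - 1),
   (∑ j, u j * z.2.2.2.1 j) + (∑ i, v i * z.2.2.2.2.1 i) + (∑ i, w i * z.2.2.2.2.2.1 i))

namespace CPBezout

open MvPolynomial Filter Topology

set_option linter.unusedSectionVars false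
set_option linter.unusedSimpArgs false

variable {ι : Type} [Fintype ι] [DecidableEq ι]

/-- The reduction operator on monomials. -/
noncomputable def redMon (d : ι → ℕ) (f : ι → MvPolynomial ι ℂ) (a : ι →₀ ℕ) :
    MvPolynomial ι ℂ :=
  open Classical in
  if h : ∃ i, d i ≤ a i then
    monomial (a - Finsupp.single h.choose (d h.choose)) 1 * f h.choose
  else 0

/-- The reduction operator. -/
noncomputable def redOp (d : ι → ℕ) (f : ι → MvPolynomial ι ℂ) :
    MvPolynomial ι ℂ →ₗ[ℂ] MvPolynomial ι ℂ :=
  (basisMonomials ι ℂ).constr ℂ (redMon d f)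

lemma redOp_monomial (d : ι → ℕ) (f : ι → MvPolynomial ι ℂ) (a : ι →₀ ℕ) :
    redOp d f (monomial a 1) = redMon d f a := by
  have := (basisMonomials ι ℂ).constr_basis ℂ (redMon d f) a
  simpa [redOp] using this

lemma redMon_degree (d : ι → ℕ) (f : ι → MvPolynomial ι ℂ)
    (hf : ∀ i, (f i).totalDegree ≤ d i) (a : ι →₀ ℕ) :
    (redMon d f a).totalDegree ≤ a.degree := by
  unfold redMon
  split_ifs with h
  · have h1 := h.choose_spec
    set i := h.choose
    refine (totalDegree_mul _ _).trans ?_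
    have h2 : (monomial (a - Finsupp.single i (d i)) (1:ℂ)).totalDegree
        ≤ (a - Finsupp.single i (d i)).degree := totalDegree_monomial_le _ _
    have h3 : a - Finsupp.single i (d i) + Finsupp.single i (d i) = a :=
      tsub_add_cancel_of_le (by simpa using h1)
    have h4 : (a - Finsupp.single i (d i)).degree + d i = a.degree := by
      conv_rhs => rw [← h3]
      rw [map_add, Finsupp.degree_single]
    have := hf i
    omega
  · simp

lemma redOp_degree (d : ι → ℕ) (f : ι → MvPolynomial ι ℂ)
    (hf : ∀ i, (f i).totalDegree ≤ d i) (D : ℕ) (p : MvPolynomial ι ℂ)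
    (hp : p ∈ restrictTotalDegree ι ℂ D) : redOp d f p ∈ restrictTotalDegree ι ℂ D := by
  rw [p.as_sum, map_sum]
  refine Submodule.sum_mem _ fun a ha => ?_
  have : monomial a (coeff a p) = coeff a p • monomial a (1:ℂ) := by
    simp [smul_monomial]
  rw [this, map_smul, redOp_monomial]
  refine Submodule.smul_mem _ _ ?_
  rw [mem_restrictTotalDegree] at hp ⊢
  exact (redMon_degree d f hf a).trans ((le_totalDegree ha).trans hp)

lemma interp (κ : Type) [Fintype κ] [DecidableEq κ] (pt : κ → ι → ℂ)
    (hpt : Function.Injective pt) (D : ℕ) (hD : Fintype.card κ ≤ D) (g : κ → ℂ) :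
    ∃ p ∈ restrictTotalDegree ι ℂ D, ∀ k, eval (pt k) p = g k := by
  have h1 : ∀ k l : κ, l ≠ k → ∃ i, pt k i ≠ pt l i := by
    intro k l hkl
    by_contra! h
    exact hkl (hpt (funext h)).symm
  choose c hc using h1
  let q : κ → κ → MvPolynomial ι ℂ := fun k l =>
    if h : l ≠ k then C ((pt k (c k l h) - pt l (c k l h))⁻¹) * (X (c k l h) - C (pt l (c k l h)))
    else 1
  have hq1 : ∀ k l, (q k l).totalDegree ≤ 1 := by
    intro k l
    by_cases h : l ≠ k
    · simp only [q, dif_pos h]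
      refine (totalDegree_mul _ _).trans ?_
      rw [totalDegree_C, zero_add]
      refine (totalDegree_sub _ _).trans ?_
      simp
    · simp only [q, dif_neg h]
      simp
  have hq2 : ∀ k l, eval (pt k) (q k l) = 1 := by
    intro k l
    by_cases h : l ≠ k
    · simp only [q, dif_pos h]
      have := sub_ne_zero.2 (hc k l h)
      simp [this]
    · simp only [q, dif_neg h]
      simp
  have hq3 : ∀ k l, l ≠ k → eval (pt l) (q k l) = 0 := by
    intro k l h
    simp [q, h]
  refine ⟨∑ k, g k • ∏ l, q k l, ?_, ?_⟩
  · refine Submodule.sum_mem _ fun k _ => Submodule.smul_mem _ _ ?_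
    rw [mem_restrictTotalDegree]
    refine (totalDegree_finsetProd _ _).trans ?_
    refine (Finset.sum_le_sum fun l _ => hq1 k l).trans ?_
    simpa using hD
  · intro k
    rw [map_sum, Finset.sum_eq_single k]
    · simp [smul_eval, hq2]
    · intro l _ hl
      rw [smul_eval, map_prod, Finset.prod_eq_zero (Finset.mem_univ k) (hq3 l k hl.symm), mul_zero]
    · simp

lemma count (d : ι → ℕ) (f : ι → MvPolynomial ι ℂ)
    (hf : ∀ i, (f i).totalDegree ≤ d i) (κ : Type) [Fintype κ] [DecidableEq κ] :
    ∀ᶠ ε in 𝓝[≠] (0:ℂ), ∀ pt : κ → ι → ℂ, Function.Injective pt →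
      (∀ k i, eval (pt k) (f i) + ε * (pt k i) ^ d i = 0) →
      Fintype.card κ ≤ ∏ i, d i := by
  set D := Fintype.card κ with hD
  let V := restrictTotalDegree ι ℂ D
  let L : Module.End ℂ V := (redOp d f).restrict (redOp_degree d f hf D)
  have hfin : (spectrum ℂ L).Finite := Module.End.finite_spectrum L
  have hfin' : ((fun ε : ℂ => -ε) ⁻¹' (spectrum ℂ L)).Finite :=
    hfin.preimage neg_injective.injOn
  have hev : ∀ᶠ ε in 𝓝[≠] (0:ℂ), -ε ∉ spectrum ℂ L := by
    have := (hfin'.subset (Set.sdiff_subset (t := {0}))).isClosed.isOpen_compl.mem_nhds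
      (x := (0:ℂ)) (by simp)
    filter_upwards [nhdsWithin_le_nhds this, self_mem_nhdsWithin] with ε h1 h2 h3
    exact h1 ⟨h3, h2⟩
  filter_upwards [hev] with ε hε pt hpt hz
  have hu : IsUnit (algebraMap ℂ (Module.End ℂ V) (-ε) - L) := by
    simpa [spectrum.mem_iff] using hε
  have hsurj : Function.Surjective (algebraMap ℂ (Module.End ℂ V) (-ε) - L) :=
    ((Module.End.isUnit_iff _).1 hu).2
  let T : MvPolynomial ι ℂ →ₗ[ℂ] (κ → ℂ) :=
    (LinearMap.pi fun k => (aeval (R := ℂ) (pt k)).toLinearMap) ∘ₗ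
      ((-ε) • LinearMap.id - redOp d f)
  have hT : LinearMap.range T = ⊤ := by
    rw [LinearMap.range_eq_top]
    intro g
    obtain ⟨p, hp, hpg⟩ := interp κ pt hpt D le_rfl g
    obtain ⟨r, hr⟩ := hsurj ⟨p, hp⟩
    refine ⟨r.1, ?_⟩
    have hr' : (-ε) • r.1 - redOp d f r.1 = p := by
      have := congrArg Subtype.val hr
      simpa [L, Module.algebraMap_end_apply] using this
    ext k
    have : T r.1 k = aeval (pt k) ((-ε) • r.1 - redOp d f r.1) := rfl
    rw [this, hr', ← hpg k, aeval_eq_eval]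
  let B : Finset (ι →₀ ℕ) :=
    (Fintype.piFinset (fun i => Finset.range (d i))).map Finsupp.equivFunOnFinite.symm.toEmbedding
  have hB : ∀ a, a ∉ B → ∃ i, d i ≤ a i := by
    intro a ha
    by_contra! h
    apply ha
    simp only [B, Finset.mem_map, Fintype.mem_piFinset, Finset.mem_range]
    exact ⟨a, h, by ext; simp⟩
  have hkill : ∀ a, a ∉ B → T (monomial a 1) = 0 := by
    intro a ha
    have h := hB a ha
    have : T (monomial a 1) = fun k => aeval (pt k) ((-ε) • monomial a (1:ℂ) - redOp d f (monomial a 1)) := rfl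
    rw [this, redOp_monomial, redMon, dif_pos h]
    have h1 := h.choose_spec
    set i := h.choose
    have h3 : a - Finsupp.single i (d i) + Finsupp.single i (d i) = a :=
      tsub_add_cancel_of_le (by simpa using h1)
    have h4 : monomial a (1:ℂ) = monomial (a - Finsupp.single i (d i)) 1 * X i ^ d i := by
      rw [X_pow_eq_monomial, monomial_mul, h3, one_mul]
    ext k
    rw [h4]
    have := hz k i
    simp only [map_sub, map_smul, map_mul, map_pow, aeval_X, coe_aeval_eq_eval, smul_eq_mul,
      RingHom.coe_coe, Pi.zero_apply]
    have h5 : eval (pt k) (f i) = - (ε * pt k i ^ d i) := eq_neg_of_add_eq_zero_left this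
    simp only [coe_aeval_eq_eval, aeval_eq_eval, h5]
    ring
  have hspan : (⊤ : Submodule ℂ (κ → ℂ)) ≤
      Submodule.span ℂ ((B.image fun a => T (monomial a 1) : Finset (κ → ℂ)) : Set (κ → ℂ)) := by
    rw [← hT, LinearMap.range_eq_map, ← (basisMonomials ι ℂ).span_eq, Submodule.map_span,
      Submodule.span_le]
    rintro _ ⟨_, ⟨a, rfl⟩, rfl⟩
    by_cases ha : a ∈ B
    · apply Submodule.subset_span
      simp only [Finset.coe_image, Set.mem_image, coe_basisMonomials]
      exact ⟨a, ha, rfl⟩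
    · simp only [coe_basisMonomials, hkill a ha]
      exact Submodule.zero_mem _
  have h6 := finrank_span_finset_le_card (R := ℂ) (B.image fun a => T (monomial a 1))
  unfold Set.finrank at h6
  rw [top_le_iff.1 hspan] at h6
  have h7 : Module.finrank ℂ (⊤ : Submodule ℂ (κ → ℂ)) = Fintype.card κ := by
    rw [finrank_top]; simp
  have h8 : B.card = ∏ i, d i := by simp [B]
  rw [← h8, hD, ← h7]
  exact h6.trans Finset.card_image_le

lemma persist {E F : Type} [NormedAddCommGroup E] [NormedSpace ℂ E] [CompleteSpace E]
    [NormedAddCommGroup F] [NormedSpace ℂ F] [CompleteSpace F] (Φ G : E → F)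
    (hΦ : ContDiff ℂ 1 Φ) (hG : ContDiff ℂ 1 G) (z : E) (hz : Φ z = 0)
    (hs : Function.Surjective (fderiv ℂ Φ z)) (U : Set E) (hU : U ∈ 𝓝 z) :
    ∀ᶠ ε in 𝓝 (0:ℂ), ∃ z' ∈ U, Φ z' + ε • G z' = 0 := by
  let H : E × ℂ → F × ℂ := fun p => (Φ p.1 + p.2 • G p.1, p.2)
  have h1 : HasStrictFDerivAt Φ (fderiv ℂ Φ z) ((z, (0:ℂ)) : E × ℂ).1 :=
    hΦ.contDiffAt.hasStrictFDerivAt (by simp)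
  have h2 : HasStrictFDerivAt G (fderiv ℂ G z) ((z, (0:ℂ)) : E × ℂ).1 :=
    hG.contDiffAt.hasStrictFDerivAt (by simp)
  have hf : HasStrictFDerivAt (Prod.fst : E × ℂ → E) (ContinuousLinearMap.fst ℂ E ℂ) (z, (0:ℂ)) :=
    hasStrictFDerivAt_fst
  have hg : HasStrictFDerivAt (Prod.snd : E × ℂ → ℂ) (ContinuousLinearMap.snd ℂ E ℂ) (z, (0:ℂ)) :=
    hasStrictFDerivAt_snd
  have h3 := ((h1.comp _ hf).add (hg.smul (h2.comp _ hf))).prodMk hg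
  have h4 := h3.map_nhds_eq_of_surj (by
    rw [LinearMap.range_eq_top]
    rintro ⟨y, t⟩
    obtain ⟨x, hx⟩ := hs (y - t • G z)
    refine ⟨(x, t), ?_⟩
    simp [hx])
  have h5 : ∀ᶠ q in 𝓝 ((0:F), (0:ℂ)), ∃ p : E × ℂ, p.1 ∈ U ∧ H p = q := by
    have hH : H (z, 0) = (0, 0) := by simp [H, hz]
    have h4' : map H (𝓝 (z, (0:ℂ))) = 𝓝 (H (z, 0)) := h4
    rw [← hH, ← h4', eventually_map]
    filter_upwards [(continuous_fst.tendsto (z, (0:ℂ))) hU] with p hp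
    exact ⟨p, hp, rfl⟩
  have h6 : Tendsto (fun ε : ℂ => ((0:F), ε)) (𝓝 0) (𝓝 (0, 0)) :=
    (Continuous.prodMk continuous_const continuous_id).tendsto 0
  filter_upwards [h6 h5] with ε ⟨p, hp, hpq⟩
  obtain ⟨ha, hb⟩ := Prod.ext_iff.1 hpq
  simp only [H] at ha hb
  exact ⟨p.1, hp, by rw [← hb]; exact ha⟩

theorem bezout {E F : Type} [NormedAddCommGroup E] [NormedSpace ℂ E] [CompleteSpace E]
    [NormedAddCommGroup F] [NormedSpace ℂ F] [CompleteSpace F] (Φ G : E → F)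
    (hΦ : ContDiff ℂ 1 Φ) (hG : ContDiff ℂ 1 G)
    (d : ι → ℕ) (f : ι → MvPolynomial ι ℂ) (hf : ∀ i, (f i).totalDegree ≤ d i)
    (Q : E → ι → ℂ) (hQ : Function.Injective Q)
    (hfe : ∀ ε z, Φ z + ε • G z = 0 → ∀ i, eval (Q z) (f i) + ε * (Q z i) ^ d i = 0) :
    Set.encard {z : E | Φ z = 0 ∧ Function.Surjective (fderiv ℂ Φ z)} ≤ ((∏ i, d i : ℕ) : ℕ∞) := by
  classical
  by_contra! hlt
  obtain ⟨t, hts, htc⟩ := Set.exists_subset_encard_eq (Order.add_one_le_of_lt hlt)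
  have htf : t.Finite := Set.finite_of_encard_eq_coe (k := (∏ i, d i) + 1) (by rw [htc]; simp)
  obtain ⟨U, hU, hdis⟩ := htf.t2_separation
  have := htf.fintype
  have h1 : ∀ᶠ ε in 𝓝[≠] (0:ℂ), ∀ z : t, ∃ z' ∈ U z, Φ z' + ε • G z' = 0 := by
    rw [eventually_all]
    intro z
    exact nhdsWithin_le_nhds (persist Φ G hΦ hG z.1 (hts z.2).1 (hts z.2).2 _
      ((hU z.1).2.mem_nhds (hU z.1).1))
  obtain ⟨ε, h2, h3⟩ := (h1.and (count d f hf t)).exists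
  choose g hgU hg using h2
  have h4 := h3 (fun k => Q (g k)) (by
    intro k l hkl
    have hkl : g k = g l := hQ hkl
    by_contra hne
    exact Set.disjoint_left.1 (hdis k.2 l.2 (fun h => hne (Subtype.ext h))) (hgU k)
      (hkl ▸ hgU l)) (fun k i => hfe ε _ (hg k) i)
  rw [Set.encard_eq_coe_toFinset_card, Set.toFinset_card] at htc
  have h5 : Fintype.card t = (∏ i, d i) + 1 := by exact_mod_cast htc
  omega

/-- Index type of the variables. -/
abbrev Idx (m n : ℕ) := Fin n ⊕ Fin m ⊕ Fin m ⊕ Fin n ⊕ Fin m ⊕ Fin m ⊕ Unit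

/-- Degrees. -/
def deg (m n : ℕ) : Idx m n → ℕ :=
  Sum.elim (fun _ => 1) <| Sum.elim (fun _ => 1) <| Sum.elim (fun _ => 2) <|
  Sum.elim (fun _ => 1) <| Sum.elim (fun _ => 1) <| Sum.elim (fun _ => 2) (fun _ => 1)

/-- Coordinates. -/
def coords {m n : ℕ} (z : CPVars ℂ m n) : Idx m n → ℂ :=
  Sum.elim z.1 <| Sum.elim z.2.1 <| Sum.elim z.2.2.1 <|
  Sum.elim z.2.2.2.1 <| Sum.elim z.2.2.2.2.1 <| Sum.elim z.2.2.2.2.2.1 (fun _ => z.2.2.2.2.2.2)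

section
variable {m n : ℕ}
/-- x -/
noncomputable def vx (j : Fin n) : MvPolynomial (Idx m n) ℂ := X (.inl j)
/-- s -/
noncomputable def vs (j : Fin m) : MvPolynomial (Idx m n) ℂ := X (.inr (.inl j))
/-- y -/
noncomputable def vy (j : Fin m) : MvPolynomial (Idx m n) ℂ := X (.inr (.inr (.inl j)))
/-- dot x -/
noncomputable def vdx (j : Fin n) : MvPolynomial (Idx m n) ℂ := X (.inr (.inr (.inr (.inl j))))
/-- dot s -/
noncomputable def vds (j : Fin m) : MvPolynomial (Idx m n) ℂ :=
  X (.inr (.inr (.inr (.inr (.inl j)))))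
/-- dot y -/
noncomputable def vdy (j : Fin m) : MvPolynomial (Idx m n) ℂ :=
  X (.inr (.inr (.inr (.inr (.inr (.inl j))))))
/-- mu -/
noncomputable def vmu : MvPolynomial (Idx m n) ℂ :=
  X (.inr (.inr (.inr (.inr (.inr (.inr ()))))))

/-- The equations, as polynomials. -/
noncomputable def polys (A : Matrix (Fin m) (Fin n) ℂ)
    (b : Fin m → ℂ) (c : Fin n → ℂ) (u : Fin n → ℂ) (v w : Fin m → ℂ) :
    Idx m n → MvPolynomial (Idx m n) ℂ :=
  Sum.elim (fun j => (∑ i, C (A i j) * vy i) - C (c j)) <|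
  Sum.elim (fun i => (∑ j, C (A i j) * vx j) - vs i - C (b i)) <|
  Sum.elim (fun i => vs i * vy i - vmu) <|
  Sum.elim (fun j => ∑ i, C (A i j) * vdy i) <|
  Sum.elim (fun i => (∑ j, C (A i j) * vdx j) - vds i) <|
  Sum.elim (fun i => vds i * vy i + vs i * vdy i - C 1)
    (fun _ => (∑ j, C (u j) * vdx j) + (∑ i, C (v i) * vds i) + (∑ i, C (w i) * vdy i))

/-- The perturbation. -/
def pert (z : CPVars ℂ m n) :
    (Fin m → ℂ) × (Fin n → ℂ) × (Fin m → ℂ) × (Fin m → ℂ) × (Fin n → ℂ) × (Fin m → ℂ) × ℂ :=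
  (z.2.1, z.1, (fun i => z.2.2.1 i ^ 2), z.2.2.2.2.1, z.2.2.2.1,
    (fun i => z.2.2.2.2.2.1 i ^ 2), z.2.2.2.2.2.2)
end

lemma td_sub {σ : Type} {p q : MvPolynomial σ ℂ} {k : ℕ} (hp : p.totalDegree ≤ k)
    (hq : q.totalDegree ≤ k) : (p - q).totalDegree ≤ k :=
  (totalDegree_sub _ _).trans (max_le hp hq)

lemma td_add {σ : Type} {p q : MvPolynomial σ ℂ} {k : ℕ} (hp : p.totalDegree ≤ k)
    (hq : q.totalDegree ≤ k) : (p + q).totalDegree ≤ k :=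
  (totalDegree_add _ _).trans (max_le hp hq)

lemma td_X {σ : Type} (i : σ) {k : ℕ} (hk : 1 ≤ k) : (X i : MvPolynomial σ ℂ).totalDegree ≤ k := by
  simpa using hk

lemma td_C {σ : Type} (a : ℂ) {k : ℕ} : (C a : MvPolynomial σ ℂ).totalDegree ≤ k := by
  simp

lemma td_XX {σ : Type} (i j : σ) : (X i * X j : MvPolynomial σ ℂ).totalDegree ≤ 2 :=
  (totalDegree_mul _ _).trans (by simp)

lemma td_lin {σ τ : Type} [Fintype τ] (a : τ → ℂ) (g : τ → σ) :
    (∑ i, C (a i) * X (g i) : MvPolynomial σ ℂ).totalDegree ≤ 1 :=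
  totalDegree_finsetSum_le fun i _ => (totalDegree_mul _ _).trans (by simp)

end CPBezout

open CPBezout

/-- **Classical Bézout bound.** The number of nonsingular complex solutions with
`μ ≠ 0` of the system `Φ^{A,b,c,u,v,w} = 0` is at most `2^{2m}`. -/
theorem bezout_bound_complex
    (m n : ℕ) (hn : 1 ≤ n) (hmn : n < m)
    (A : Matrix (Fin m) (Fin n) ℂ)
    (b : Fin m → ℂ) (c : Fin n → ℂ) (u : Fin n → ℂ) (v w : Fin m → ℂ) :
    Set.encard {z : CPVars ℂ m n |
        z.2.2.2.2.2.2 ≠ 0 ∧ cpPhi A b c u v w z = 0 ∧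
        Function.Bijective (fderiv ℂ (cpPhi A b c u v w) z)}
      ≤ ((2 ^ (2 * m) : ℕ) : ℕ∞) := by
  have hdeg : ∏ i, deg m n i = 2 ^ (2 * m) := by
    simp [deg, Fintype.prod_sum_type]
    ring
  have hΦ : ContDiff ℂ 1 (cpPhi A b c u v w) := by
    unfold cpPhi Matrix.mulVec dotProduct
    refine ContDiff.prodMk ?_ (ContDiff.prodMk ?_ (ContDiff.prodMk ?_ (ContDiff.prodMk ?_
      (ContDiff.prodMk ?_ (ContDiff.prodMk ?_ ?_)))))
    all_goals first | fun_prop | (rw [contDiff_pi]; intro i; simp only [Pi.sub_apply]; fun_prop)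
  have hG : ContDiff ℂ 1 (pert : CPVars ℂ m n → _) := by
    unfold pert
    fun_prop
  refine (Set.encard_le_encard ?_).trans ((bezout (cpPhi A b c u v w) pert hΦ hG (deg m n)
    (polys A b c u v w) ?_ coords ?_ ?_).trans (by rw [hdeg]))
  · rintro z ⟨-, h1, h2⟩
    exact ⟨h1, h2.2⟩
  · rintro (i | i | i | i | i | i | i) <;>
      simp only [polys, deg, Sum.elim_inl, Sum.elim_inr, vx, vs, vy, vdx, vds, vdy, vmu]
    · exact td_sub (td_lin _ _) (td_C _)
    · exact td_sub (td_sub (td_lin _ _) (td_X _ le_rfl)) (td_C _)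
    · exact td_sub (td_XX _ _) (td_X _ one_le_two)
    · exact td_lin _ _
    · exact td_sub (td_lin _ _) (td_X _ le_rfl)
    · exact td_sub (td_add (td_XX _ _) (td_XX _ _)) (td_C _)
    · exact td_add (td_add (td_lin _ _) (td_lin _ _)) (td_lin _ _)
  · rintro ⟨x, s, y, dx, ds, dy, μ⟩ ⟨x', s', y', dx', ds', dy', μ'⟩ h
    have h := congrFun h
    simp only [Prod.mk.injEq]
    exact ⟨funext fun i => h (.inl i), funext fun i => h (.inr (.inl i)),
      funext fun i => h (.inr (.inr (.inl i))), funext fun i => h (.inr (.inr (.inr (.inl i)))),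
      funext fun i => h (.inr (.inr (.inr (.inr (.inl i))))),
      funext fun i => h (.inr (.inr (.inr (.inr (.inr (.inl i)))))),
      h (.inr (.inr (.inr (.inr (.inr (.inr ()))))))⟩
  · rintro ε ⟨x, s, y, dx, ds, dy, μ⟩ h
    simp only [cpPhi, pert, Prod.smul_mk, Prod.mk_add_mk, Prod.mk_eq_zero] at h
    obtain ⟨h1, h2, h3, h4, h5, h6, h7⟩ := h
    rintro (i | i | i | i | i | i | i) <;>
      simp only [polys, deg, coords, Sum.elim_inl, Sum.elim_inr, vx, vs, vy, vdx, vds, vdy, vmu,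
        map_sub, map_add, map_sum, map_mul, MvPolynomial.eval_C, MvPolynomial.eval_X, pow_one]
    · simpa [Matrix.mulVec, dotProduct] using congrFun h2 i
    · simpa [Matrix.mulVec, dotProduct] using congrFun h1 i
    · simpa using congrFun h3 i
    · simpa [Matrix.mulVec, dotProduct] using congrFun h5 i
    · simpa [Matrix.mulVec, dotProduct] using congrFun h4 i
    · simpa using congrFun h6 i
    · simpa using h7
end

section
/- Let m > n ≥ 1. For Lebesgue-almost every tuple (A, b, c, u, v, w), where A is a complex m×n matrix, b ∈ ℂ^m, c ∈ ℂ^n, u ∈ ℂ^n, and v, w ∈ ℂ^m, every solution z = (x, s, y, ẋ, ṡ, ẏ, μ) ∈ ℂ^{2n+4m+1} of Φ^{A,b,c,u,v,w}(z) = 0 with μ ≠ 0 is nonsingular, i.e. the derivative DΦ^{A,b,c,u,v,w}(z) is invertible. -/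
open MeasureTheory

lemma exists_straighten {V W E : Type*} [NormedAddCommGroup V] [NormedSpace ℝ V]
    [NormedAddCommGroup W] [NormedSpace ℝ W] [NormedAddCommGroup E] [NormedSpace ℝ E]
    [FiniteDimensional ℝ V] [FiniteDimensional ℝ W] [FiniteDimensional ℝ E]
    (hd : Module.finrank ℝ V = Module.finrank ℝ W + Module.finrank ℝ E)
    (f : V →L[ℝ] W) (hf : Function.Surjective f) :
    ∃ (L : V →L[ℝ] E) (e : V ≃L[ℝ] (W × E)), (e : V →L[ℝ] (W × E)) = f.prod L := by
  have h1 := LinearMap.finrank_range_add_finrank_ker (f : V →ₗ[ℝ] W)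
  have h2 : LinearMap.range (f : V →ₗ[ℝ] W) = ⊤ := LinearMap.range_eq_top.2 hf
  rw [h2, finrank_top] at h1
  have h3 : Module.finrank ℝ (LinearMap.ker (f : V →ₗ[ℝ] W)) = Module.finrank ℝ E := by omega
  let i := LinearEquiv.ofFinrankEq _ _ h3
  obtain ⟨p, hp⟩ := LinearMap.exists_leftInverse_of_injective
    (LinearMap.ker (f : V →ₗ[ℝ] W)).subtype (by simp)
  let L : V →L[ℝ] E := LinearMap.toContinuousLinearMap ((i : _ →ₗ[ℝ] E) ∘ₗ p)
  have hinj : Function.Injective ((f.prod L : V →L[ℝ] W × E) : V →ₗ[ℝ] W × E) := by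
    rw [injective_iff_map_eq_zero]
    intro x hx
    have hx1 : f x = 0 := congrArg Prod.fst hx
    have hx2 : i (p x) = 0 := congrArg Prod.snd hx
    have hx3 : p x = 0 := by simpa using hx2
    have := LinearMap.congr_fun hp ⟨x, hx1⟩
    simp only [LinearMap.comp_apply, Submodule.subtype_apply, hx3, LinearMap.id_apply] at this
    exact (congrArg Subtype.val this).symm
  have hsurj := (LinearMap.injective_iff_surjective_of_finrank_eq_finrank
    (by rw [hd, Module.finrank_prod])).1 hinj
  refine ⟨L, (LinearEquiv.ofBijective _ ⟨hinj, hsurj⟩).toContinuousLinearEquiv, ?_⟩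
  ext x <;> rfl

lemma sard_param_real {E Z W : Type*} [NormedAddCommGroup E] [NormedSpace ℝ E]
    [NormedAddCommGroup Z] [NormedSpace ℝ Z] [NormedAddCommGroup W] [NormedSpace ℝ W]
    [FiniteDimensional ℝ E] [FiniteDimensional ℝ Z] [FiniteDimensional ℝ W]
    [MeasurableSpace E] [BorelSpace E] (μ : Measure E) [μ.IsAddHaarMeasure]
    (hd : Module.finrank ℝ Z = Module.finrank ℝ W)
    (F : E × Z → W) (hF : ContDiff ℝ 1 F) :
    μ (Prod.fst '' {q : E × Z | F q = 0 ∧ Function.Surjective (fderiv ℝ F q) ∧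
      ¬ Function.Surjective (fun z : Z => fderiv ℝ F q (0, z))}) = 0 := by
  set S := {q : E × Z | F q = 0 ∧ Function.Surjective (fderiv ℝ F q) ∧
      ¬ Function.Surjective (fun z : Z => fderiv ℝ F q (0, z))} with hS
  have key : ∀ q ∈ S, ∃ u ∈ nhdsWithin q S, μ (Prod.fst '' u) = 0 := by
    intro q0 hq0
    obtain ⟨L, e, he⟩ := exists_straighten (E := E)
      (by rw [Module.finrank_prod, hd, add_comm]) (fderiv ℝ F q0) hq0.2.1
    let G : E × Z → W × E := fun q => (F q, L q)
    have hG : ContDiff ℝ 1 G := hF.prodMk L.contDiff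
    have hG' : HasFDerivAt G (e : E × Z →L[ℝ] W × E) q0 := by
      rw [he]
      exact ((hF.differentiable one_ne_zero) q0).hasFDerivAt.prodMk L.hasFDerivAt
    let H := hG.contDiffAt.toOpenPartialHomeomorph G hG' one_ne_zero
    have hHG : (H : E × Z → W × E) = G := rfl
    have hsrc : q0 ∈ H.source :=
      hG.contDiffAt.mem_toOpenPartialHomeomorph_source hG' one_ne_zero
    have hΨ : ContDiffAt ℝ 1 H.symm (G q0) :=
      hG.contDiffAt.to_localInverse hG' one_ne_zero
    have hev : ∀ᶠ y in nhds (G q0), ContDiffAt ℝ 1 H.symm y := hΨ.eventually (by simp)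
    have hev2 : ∀ᶠ q in nhds q0, ContDiffAt ℝ 1 H.symm (G q) :=
      hG.continuous.continuousAt.eventually hev
    let u := {q | q ∈ S ∧ q ∈ H.source ∧ ContDiffAt ℝ 1 H.symm (G q)}
    refine ⟨u, ?_, ?_⟩
    · have h1 : ∀ᶠ q in nhdsWithin q0 S, q ∈ H.source :=
        nhdsWithin_le_nhds (H.open_source.mem_nhds hsrc)
      filter_upwards [self_mem_nhdsWithin, h1, nhdsWithin_le_nhds hev2] with q a b c
      exact ⟨a, b, c⟩
    · let g : E → E × Z := fun k => H.symm (0, k)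
      have hsub : Prod.fst '' u ⊆ (fun k => (g k).1) '' (L '' u) := by
        rintro _ ⟨q, hq, rfl⟩
        refine ⟨L q, ⟨q, hq, rfl⟩, ?_⟩
        have : H.symm (H q) = q := H.left_inv hq.2.1
        have h0 : H q = (0, L q) := by rw [hHG]; exact Prod.ext hq.1.1 rfl
        rw [h0] at this
        simp only [g, this]
      refine measure_mono_null hsub ?_
      have main : ∀ k ∈ L '' u, HasFDerivAt (fun k => (g k).1)
          ((ContinuousLinearMap.fst ℝ E Z).comp (fderiv ℝ g k)) k ∧
          ((ContinuousLinearMap.fst ℝ E Z).comp (fderiv ℝ g k)).det = 0 := by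
        rintro _ ⟨q, hq, rfl⟩
        have h0 : G q = (0, L q) := Prod.ext hq.1.1 rfl
        have hgq : g (L q) = q := by
          have : H.symm (H q) = q := H.left_inv hq.2.1
          rw [hHG, h0] at this; exact this
        have hd1 : DifferentiableAt ℝ g (L q) := by
          have := hq.2.2.differentiableAt one_ne_zero
          rw [h0] at this
          exact this.comp (L q) (by fun_prop : DifferentiableAt ℝ (fun k : E => ((0 : W), k)) (L q))
        have hFg : (fderiv ℝ F q).comp (fderiv ℝ g (L q)) = 0 := by
          have e1 : HasFDerivAt (fun k => F (g k)) ((fderiv ℝ F q).comp (fderiv ℝ g (L q))) (L q) := by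
            have : HasFDerivAt F (fderiv ℝ F q) (g (L q)) := by
              rw [hgq]; exact ((hF.differentiable one_ne_zero) q).hasFDerivAt
            exact this.comp (L q) hd1.hasFDerivAt
          have e2 : (fun k => F (g k)) =ᶠ[nhds (L q)] fun _ => (0 : W) := by
            have htgt : (0, L q) ∈ H.target := by
              rw [← h0]; exact H.map_source hq.2.1
            have hc : ContinuousAt (fun k : E => ((0 : W), k)) (L q) := by fun_prop
            filter_upwards [hc.eventually (H.open_target.mem_nhds htgt)] with k hk
            exact congrArg Prod.fst (H.right_inv hk)
          exact e1.unique ((hasFDerivAt_const (0 : W) (L q)).congr_of_eventuallyEq e2)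
        refine ⟨(ContinuousLinearMap.fst ℝ E Z).hasFDerivAt.comp (L q) hd1.hasFDerivAt, ?_⟩
        by_contra hdet
        apply hq.1.2.2
        intro w
        obtain ⟨⟨p, z⟩, hpz⟩ := hq.1.2.1 w
        let D := (ContinuousLinearMap.fst ℝ E Z).comp (fderiv ℝ g (L q))
        have hDs : Function.Surjective D := by
          have := ((LinearMap.equivOfDetNeZero (D : E →ₗ[ℝ] E) hdet)).surjective
          exact this
        obtain ⟨h, hh⟩ := hDs p
        have h2 : fderiv ℝ F q (fderiv ℝ g (L q) h) = 0 := by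
          have := congrArg (fun T => T h) hFg
          simpa using this
        refine ⟨z - (fderiv ℝ g (L q) h).2, ?_⟩
        have h3 : ((0 : E), z - (fderiv ℝ g (L q) h).2) = (p, z) - fderiv ℝ g (L q) h := by
          refine Prod.ext ?_ rfl
          have : (fderiv ℝ g (L q) h).1 = p := hh
          simp [this]
        show fderiv ℝ F q (0, z - (fderiv ℝ g (L q) h).2) = w
        rw [h3, map_sub, hpz, h2, sub_zero]
      exact addHaar_image_eq_zero_of_det_fderivWithin_eq_zero μ
        (fun k hk => (main k hk).1.hasFDerivWithinAt) (fun k hk => (main k hk).2)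
  choose! u hu hu0 using key
  obtain ⟨t, ts, tc, ht⟩ := TopologicalSpace.countable_cover_nhdsWithin hu
  have : Prod.fst '' S ⊆ ⋃ x ∈ t, Prod.fst '' u x := by
    rw [← Set.image_iUnion₂]; exact Set.image_mono ht
  refine measure_mono_null this ((measure_biUnion_null_iff tc).2 fun x hx => hu0 x (ts hx))

lemma sard_param {E Z W : Type*} [NormedAddCommGroup E] [NormedSpace ℂ E]
    [NormedAddCommGroup Z] [NormedSpace ℂ Z] [NormedAddCommGroup W] [NormedSpace ℂ W]
    [FiniteDimensional ℂ E] [FiniteDimensional ℂ Z] [FiniteDimensional ℂ W]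
    [MeasurableSpace E] [BorelSpace E] (μ : Measure E) [μ.IsAddHaarMeasure]
    (hd : Module.finrank ℂ Z = Module.finrank ℂ W)
    (F : E × Z → W) (hF : ContDiff ℂ 1 F) :
    μ (Prod.fst '' {q : E × Z | F q = 0 ∧ Function.Surjective (fderiv ℂ F q) ∧
      ¬ Function.Surjective (fun z : Z => fderiv ℂ F q (0, z))}) = 0 := by
  have := sard_param_real μ (Z := Z) (W := W)
    (by rw [finrank_real_of_complex, finrank_real_of_complex, hd]) F (hF.restrict_scalars ℝ)
  have h : ∀ q, fderiv ℝ F q = (fderiv ℂ F q).restrictScalars ℝ := fun q =>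
    ((hF.differentiable one_ne_zero) q).fderiv_restrictScalars ℝ
  simpa only [h, ContinuousLinearMap.coe_restrictScalars'] using this

/-- The parameter space. -/
abbrev CPParams (m n : ℕ) := (Fin m → Fin n → ℂ) × (Fin m → ℂ) × (Fin n → ℂ) ×
        (Fin n → ℂ) × (Fin m → ℂ) × (Fin m → ℂ)


set_option synthInstance.maxSize 1000 in
set_option synthInstance.maxHeartbeats 400000 in
lemma cpParams_borel (m n : ℕ) : BorelSpace (CPParams m n) := inferInstance

lemma haar_prod {E F : Type*} [NormedAddCommGroup E] [NormedAddCommGroup F]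
    [MeasureSpace E] [MeasureSpace F] [BorelSpace E] [BorelSpace F]
    [SecondCountableTopology E] [SecondCountableTopology F]
    [SigmaFinite (volume : Measure E)] [SigmaFinite (volume : Measure F)]
    (h1 : (volume : Measure E).IsAddHaarMeasure) (h2 : (volume : Measure F).IsAddHaarMeasure) :
    (volume : Measure (E × F)).IsAddHaarMeasure := by
  rw [Measure.volume_eq_prod]
  infer_instance

lemma haar_pi (m : ℕ) : (volume : Measure (Fin m → ℂ)).IsAddHaarMeasure := inferInstance

lemma haar_pi2 (m n : ℕ) : (volume : Measure (Fin m → Fin n → ℂ)).IsAddHaarMeasure :=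
  Measure.instIsAddHaarMeasureForallVolumeOfMeasurableAddOfSigmaFinite

set_option synthInstance.maxSize 1000 in
set_option synthInstance.maxHeartbeats 400000 in
lemma cpParams_haar (m n : ℕ) : (volume : Measure (CPParams m n)).IsAddHaarMeasure :=
  haar_prod (haar_pi2 m n) <| haar_prod (haar_pi m) <| haar_prod (haar_pi n) <|
    haar_prod (haar_pi n) <| haar_prod (haar_pi m) (haar_pi m)

instance instBorelCP (m n : ℕ) : BorelSpace (CPParams m n) := cpParams_borel m n
instance instHaarCP (m n : ℕ) : (volume : Measure (CPParams m n)).IsAddHaarMeasure :=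
  cpParams_haar m n

/-- The codomain. -/
abbrev CPCod (m n : ℕ) :=
  (Fin m → ℂ) × (Fin n → ℂ) × (Fin m → ℂ) × (Fin m → ℂ) × (Fin n → ℂ) × (Fin m → ℂ) × ℂ

/-- The joint map. -/
noncomputable def cpF (m n : ℕ) (q : CPParams m n × CPVars ℂ m n) : CPCod m n :=
  cpPhi (Matrix.of q.1.1) q.1.2.1 q.1.2.2.1 q.1.2.2.2.1 q.1.2.2.2.2.1 q.1.2.2.2.2.2 q.2

lemma cpF_contDiff (m n : ℕ) : ContDiff ℂ 1 (cpF m n) := by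
  unfold cpF cpPhi
  refine ContDiff.prodMk ?_ (ContDiff.prodMk ?_ (ContDiff.prodMk ?_ (ContDiff.prodMk ?_
    (ContDiff.prodMk ?_ (ContDiff.prodMk ?_ ?_)))))
  all_goals first
    | (rw [contDiff_pi]; intro i; simp only [Pi.sub_apply, Matrix.mulVec, dotProduct,
        Matrix.transpose_apply, Matrix.of_apply]; fun_prop)
    | fun_prop

lemma hd_mul (a a' b b' : ℂ) :
    HasDerivAt (fun t : ℂ => (a + t * a') * (b + t * b')) (a * b' + a' * b) 0 := by
  have h1 : HasDerivAt (fun t : ℂ => a + t * a') a' 0 := by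
    simpa using ((hasDerivAt_id (0 : ℂ)).mul_const a').const_add a
  have h2 : HasDerivAt (fun t : ℂ => b + t * b') b' 0 := by
    simpa using ((hasDerivAt_id (0 : ℂ)).mul_const b').const_add b
  exact (h1.mul h2).congr_deriv (by simp; ring)

lemma hd_lin (a a' : ℂ) :
    HasDerivAt (fun t : ℂ => (a + t * a')) a' 0 := by
  simpa using ((hasDerivAt_id (0 : ℂ)).mul_const a').const_add a

lemma cpF_fderiv (m n : ℕ) (A A' : Fin m → Fin n → ℂ) (b b' v v' w w' s s' y y' ds ds' dy dy' : Fin m → ℂ)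
    (c c' u u' x x' dx dx' : Fin n → ℂ) (μ μ' : ℂ) :
    fderiv ℂ (cpF m n) ((A, b, c, u, v, w), (x, s, y, dx, ds, dy, μ))
      ((A', b', c', u', v', w'), (x', s', y', dx', ds', dy', μ')) =
    ((fun i => (∑ j, (A i j * x' j + A' i j * x j)) - s' i - b' i),
     (fun j => (∑ i, (A i j * y' i + A' i j * y i)) - c' j),
     (fun i => s i * y' i + s' i * y i - μ'),
     (fun i => (∑ j, (A i j * dx' j + A' i j * dx j)) - ds' i),
     (fun j => (∑ i, (A i j * dy' i + A' i j * dy i))),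
     (fun i => (ds i * y' i + ds' i * y i) + (s i * dy' i + s' i * dy i)),
     (∑ j, (u j * dx' j + u' j * dx j)) + (∑ i, (v i * ds' i + v' i * ds i))
       + (∑ i, (w i * dy' i + w' i * dy i))) := by
  set q : CPParams m n × CPVars ℂ m n := ((A, b, c, u, v, w), (x, s, y, dx, ds, dy, μ)) with hq
  set d : CPParams m n × CPVars ℂ m n :=
    ((A', b', c', u', v', w'), (x', s', y', dx', ds', dy', μ')) with hd
  have h1 : HasDerivAt (fun t : ℂ => cpF m n (q + t • d)) (fderiv ℂ (cpF m n) q d) 0 := by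
    have h2 : HasDerivAt (fun t : ℂ => q + t • d) d 0 := by
      simpa using ((hasDerivAt_id (0 : ℂ)).smul_const d).const_add q
    have h3 : HasFDerivAt (cpF m n) (fderiv ℂ (cpF m n) q) (q + (0 : ℂ) • d) := by
      rw [zero_smul, add_zero]
      exact (((cpF_contDiff m n).differentiable one_ne_zero) q).hasFDerivAt
    exact h3.comp_hasDerivAt 0 h2
  refine h1.unique ?_
  unfold cpF cpPhi
  simp only [hq, hd, Prod.smul_mk, Prod.mk_add_mk, Pi.add_apply, Pi.smul_apply, smul_eq_mul]
  refine HasDerivAt.prodMk ?_ (HasDerivAt.prodMk ?_ (HasDerivAt.prodMk ?_ (HasDerivAt.prodMk ?_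
    (HasDerivAt.prodMk ?_ (HasDerivAt.prodMk ?_ ?_)))))
  · rw [hasDerivAt_pi]; intro i
    exact ((HasDerivAt.fun_sum fun j _ => hd_mul _ _ _ _).sub (hd_lin _ _)).sub (hd_lin _ _)
  · rw [hasDerivAt_pi]; intro i
    exact (HasDerivAt.fun_sum fun j _ => hd_mul _ _ _ _).sub (hd_lin _ _)
  · rw [hasDerivAt_pi]; intro i
    exact (hd_mul _ _ _ _).sub (hd_lin _ _)
  · rw [hasDerivAt_pi]; intro i
    exact (HasDerivAt.fun_sum fun j _ => hd_mul _ _ _ _).sub (hd_lin _ _)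
  · rw [hasDerivAt_pi]; intro i
    exact (HasDerivAt.fun_sum (u := Finset.univ) fun j _ =>
      hd_mul (A j i) (A' j i) (dy j) (dy' j))
  · rw [hasDerivAt_pi]; intro i
    exact ((hd_mul _ _ _ _).add (hd_mul _ _ _ _)).sub_const _
  · exact ((HasDerivAt.fun_sum fun j _ => hd_mul _ _ _ _).add
      (HasDerivAt.fun_sum fun j _ => hd_mul _ _ _ _)).add
      (HasDerivAt.fun_sum fun j _ => hd_mul _ _ _ _)

lemma functional_pi {k : ℕ} (l : (Fin k → ℂ) →ₗ[ℂ] ℂ) :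
    ∃ a : Fin k → ℂ, ∀ w, l w = ∑ i, a i * w i := by
  refine ⟨fun i => l (Pi.single i 1), fun w => ?_⟩
  rw [LinearMap.pi_apply_eq_sum_univ l w]
  refine Finset.sum_congr rfl fun i _ => ?_
  rw [smul_eq_mul, mul_comm]
  congr 2
  ext j
  simp [Pi.single_apply, eq_comm]

lemma functional_cod {m n : ℕ} (l : CPCod m n →ₗ[ℂ] ℂ) :
    ∃ (l1 l3 l4 l6 : Fin m → ℂ) (l2 l5 : Fin n → ℂ) (l7 : ℂ), ∀ w1 w2 w3 w4 w5 w6 w7,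
      l (w1, w2, w3, w4, w5, w6, w7) =
      ∑ i, l1 i * w1 i + ∑ i, l2 i * w2 i + ∑ i, l3 i * w3 i + ∑ i, l4 i * w4 i
      + ∑ i, l5 i * w5 i + ∑ i, l6 i * w6 i + l7 * w7 := by
  obtain ⟨l1, h1⟩ := functional_pi (l ∘ₗ LinearMap.inl ℂ _ _)
  let r2 := l ∘ₗ LinearMap.inr ℂ _ _
  obtain ⟨l2, h2⟩ := functional_pi (r2 ∘ₗ LinearMap.inl ℂ _ _)
  let r3 := r2 ∘ₗ LinearMap.inr ℂ _ _
  obtain ⟨l3, h3⟩ := functional_pi (r3 ∘ₗ LinearMap.inl ℂ _ _)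
  let r4 := r3 ∘ₗ LinearMap.inr ℂ _ _
  obtain ⟨l4, h4⟩ := functional_pi (r4 ∘ₗ LinearMap.inl ℂ _ _)
  let r5 := r4 ∘ₗ LinearMap.inr ℂ _ _
  obtain ⟨l5, h5⟩ := functional_pi (r5 ∘ₗ LinearMap.inl ℂ _ _)
  let r6 := r5 ∘ₗ LinearMap.inr ℂ _ _
  obtain ⟨l6, h6⟩ := functional_pi (r6 ∘ₗ LinearMap.inl ℂ _ _)
  let r7 := r6 ∘ₗ LinearMap.inr ℂ _ _
  refine ⟨l1, l3, l4, l6, l2, l5, r7 1, fun w1 w2 w3 w4 w5 w6 w7 => ?_⟩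
  rw [← h1, ← h2, ← h3, ← h4, ← h5, ← h6]
  have h7 : r7 1 * w7 = r7 w7 := by
    rw [mul_comm, ← smul_eq_mul, ← map_smul, smul_eq_mul, mul_one]
  rw [h7]
  simp only [r7, r6, r5, r4, r3, r2, LinearMap.comp_apply, ← map_add]
  congr 1
  simp

lemma exists_functional {V W : Type*} [AddCommGroup V] [Module ℂ V] [AddCommGroup W] [Module ℂ W]
    (f : V →ₗ[ℂ] W) (h : ∀ l : W →ₗ[ℂ] ℂ, (∀ d, l (f d) = 0) → l = 0) : Function.Surjective f := by
  rw [← LinearMap.range_eq_top]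
  by_contra hne
  obtain ⟨l, hl, hle⟩ := Submodule.exists_le_ker_of_lt_top _ (lt_top_iff_ne_top.2 hne)
  exact hl (h l fun d => hle ⟨d, rfl⟩)

lemma cpF_surj (m n : ℕ) (hm : 0 < m) (A : Fin m → Fin n → ℂ) (b v w s y ds dy : Fin m → ℂ)
    (c u x dx : Fin n → ℂ) (μ : ℂ) (hμ : μ ≠ 0)
    (hA : ∀ z : Fin n → ℂ, (∀ i, ∑ j, A i j * z j = 0) → z = 0)
    (hdx : dx ≠ 0)
    (h3 : ∀ i, s i * y i = μ) (h4 : ∀ i, ∑ j, A i j * dx j = ds i)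
    (h6 : ∀ i, ds i * y i + s i * dy i = 1) :
    Function.Surjective
      (fderiv ℂ (cpF m n) ((A, b, c, u, v, w), (x, s, y, dx, ds, dy, μ))) := by
  refine exists_functional (fderiv ℂ (cpF m n)
    ((A, b, c, u, v, w), (x, s, y, dx, ds, dy, μ))).toLinearMap fun l hl => ?_
  obtain ⟨l1, l3, l4, l6, l2, l5, l7, hform⟩ := functional_cod l
  have key : ∀ (A' : Fin m → Fin n → ℂ) (b' s' y' ds' dy' : Fin m → ℂ)
    (c' u' : Fin n → ℂ) (μ' : ℂ), _ := fun A' b' s' y' ds' dy' c' u' μ' =>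
      hl ((A', b', c', u', 0, 0), (0, s', y', 0, ds', dy', μ'))
  simp only [ContinuousLinearMap.coe_coe, cpF_fderiv, hform] at key
  clear hl
  have hy : ∀ i, y i ≠ 0 := fun i h => hμ (by rw [← h3 i, h, mul_zero])
  have hs : ∀ i, s i ≠ 0 := fun i h => hμ (by rw [← h3 i, h, zero_mul])
  obtain ⟨j0, hj0⟩ := Function.ne_iff.1 hdx
  simp only [Pi.zero_apply] at hj0
  have z1 : ∀ i, l1 i = 0 := fun i => by
    simpa [Pi.single_apply] using key 0 (Pi.single i 1) 0 0 0 0 0 0 0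
  have z2 : ∀ i, l2 i = 0 := fun i => by
    simpa [Pi.single_apply] using key 0 0 0 0 0 0 (Pi.single i 1) 0 0
  have z7 : l7 = 0 := by
    have := key 0 0 0 0 0 0 0 (Pi.single j0 1) 0
    simpa [Pi.single_apply, hj0] using this
  simp only [z1, z2, z7, zero_mul, Finset.sum_const_zero, zero_add, add_zero] at key
  have e4 : ∀ i, l4 i = l6 i * y i := fun i => by
    have := key 0 0 0 0 (Pi.single i 1) 0 0 0 0
    simp [Pi.single_apply] at this
    linear_combination -this
  have e5 : ∀ i, ∑ j, A i j * l5 j + l6 i * s i = 0 := fun i => by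
    have := key 0 0 0 0 0 (Pi.single i 1) 0 0 0
    simp [Pi.single_apply] at this
    simp_rw [mul_comm (A i _)]
    exact this
  have eA : ∀ i j, l4 i * dx j + l5 j * dy i = 0 := fun i j => by
    have := key (Pi.single i (Pi.single j 1)) 0 0 0 0 0 0 0 0
    simpa [Pi.single_apply, ite_apply, ite_and, Finset.sum_ite_eq] using this
  have e3 : ∀ i, l3 i * y i + l6 i * dy i = 0 := fun i => by
    have := key 0 0 (Pi.single i 1) 0 0 0 0 0 0
    simpa [Pi.single_apply] using this
  have eμ : ∑ i, l3 i = 0 := by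
    have := key 0 0 0 0 0 0 0 0 1
    simpa using this
  have fin : (∀ i, l4 i = 0) ∧ (∀ j, l5 j = 0) := by
    by_cases hdy : ∀ i, dy i = 0
    · have q4 : ∀ i, l4 i = 0 := fun i => by
        have := eA i j0
        simpa [hdy i, hj0] using this
      refine ⟨q4, ?_⟩
      have : l5 = 0 := hA l5 fun i => by
        have h := e5 i
        have : l6 i = 0 := by
          have := e4 i
          rw [q4 i] at this
          simpa [hy i] using this.symm
        simpa [this] using h
      intro j; rw [this]; rfl
    · push Not at hdy
      obtain ⟨i0, hi0⟩ := hdy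
      set t := -l5 j0 / dx j0 with ht
      have q4 : ∀ i, l4 i = t * dy i := fun i => by
        rw [ht]; field_simp
        linear_combination eA i j0
      have q5 : ∀ j, l5 j = -t * dx j := fun j => by
        apply mul_right_cancel₀ hi0
        linear_combination eA i0 j - dx j * q4 i0
      have q6 : ∀ i, l6 i * s i = t * ds i := fun i => by
        have := e5 i
        simp_rw [q5] at this
        have h : ∑ j, A i j * (-t * dx j) = -t * ds i := by
          rw [← h4 i, Finset.mul_sum]
          exact Finset.sum_congr rfl fun j _ => by ring
        rw [h] at this
        linear_combination this
      have q7 : ∀ i, 2 * μ * l6 i = t := fun i => by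
        linear_combination (-2 * l6 i) * h3 i + t * h6 i - s i * e4 i + s i * q4 i + y i * q6 i
      have q8 : ∀ i, t * (4 * μ ^ 2 * l3 i) = - t ^ 2 := fun i => by
        have a : t * l3 i = -(l6 i) ^ 2 := by
          apply mul_right_cancel₀ (hy i)
          linear_combination t * e3 i - l6 i * e4 i + l6 i * q4 i
        rw [← q7 i] at a ⊢
        linear_combination 4 * μ ^ 2 * a
      have q9 : (m : ℂ) * t ^ 2 = 0 := by
        have : ∑ i, t * (4 * μ ^ 2 * l3 i) = ∑ i : Fin m, - t ^ 2 :=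
          Finset.sum_congr rfl fun i _ => q8 i
        rw [← Finset.mul_sum, ← Finset.mul_sum, eμ] at this
        simp at this
        rcases this with h | h
        · omega
        · simp [h]
      have ht0 : t = 0 := by
        rcases mul_eq_zero.1 q9 with h | h
        · exact absurd (Nat.cast_eq_zero.1 h) hm.ne'
        · exact pow_eq_zero_iff (two_ne_zero) |>.1 h
      exact ⟨fun i => by rw [q4, ht0, zero_mul], fun j => by rw [q5, ht0, neg_zero, zero_mul]⟩
  obtain ⟨z4, z5⟩ := fin
  have z6 : ∀ i, l6 i = 0 := fun i => by
    have := e4 i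
    rw [z4 i] at this
    simpa [hy i] using this.symm
  have z3 : ∀ i, l3 i = 0 := fun i => by
    have := e3 i
    simpa [z6 i, hy i] using this
  refine LinearMap.ext fun ⟨w1, w2, w3, w4, w5, w6, w7⟩ => ?_
  rw [hform]
  simp [z1, z2, z3, z4, z5, z6, z7]

lemma inj_ae (m n : ℕ) (hmn : n < m) : ∀ᵐ P : CPParams m n,
    ∀ z : Fin n → ℂ, (∀ i, ∑ j, P.1 i j * z j = 0) → z = 0 := by
  let F : CPParams m n × (Fin n → ℂ) → (Fin n → ℂ) :=
    fun q i => ∑ j, q.1.1 (Fin.castLE hmn.le i) j * q.2 j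
  have hF : ContDiff ℂ 1 F := by
    rw [contDiff_pi]; intro i; simp only [F]; fun_prop
  have hfd : ∀ (P P' : CPParams m n) (z z' : Fin n → ℂ), fderiv ℂ F (P, z) (P', z') =
      fun i => ∑ j, (P.1 (Fin.castLE hmn.le i) j * z' j + P'.1 (Fin.castLE hmn.le i) j * z j) := by
    intro P P' z z'
    have h1 : HasDerivAt (fun t : ℂ => F ((P, z) + t • (P', z'))) (fderiv ℂ F (P, z) (P', z')) 0 := by
      have h2 : HasDerivAt (fun t : ℂ => (P, z) + t • (P', z')) (P', z') 0 := by
        simpa using ((hasDerivAt_id (0 : ℂ)).smul_const (P', z')).const_add (P, z)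
      have h3 : HasFDerivAt F (fderiv ℂ F (P, z)) ((P, z) + (0 : ℂ) • (P', z')) := by
        rw [zero_smul, add_zero]
        exact ((hF.differentiable one_ne_zero) (P, z)).hasFDerivAt
      exact h3.comp_hasDerivAt 0 h2
    refine h1.unique ?_
    rw [hasDerivAt_pi]; intro i
    exact (HasDerivAt.fun_sum fun j _ => hd_mul _ _ _ _)
  have := sard_param (volume : Measure (CPParams m n)) rfl F hF
  rw [ae_iff]
  refine measure_mono_null ?_ this
  intro P hP
  simp only [Set.mem_ofPred_eq, not_forall] at hP
  obtain ⟨z, hz, hz0⟩ := hP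
  refine ⟨(P, z), ⟨?_, ?_, ?_⟩, rfl⟩
  · ext i; exact hz _
  · obtain ⟨j0, hj0⟩ := Function.ne_iff.1 hz0
    simp only [Pi.zero_apply] at hj0
    intro w
    refine ⟨((fun i j => if h : i.1 < n then (if j = j0 then w ⟨i, h⟩ / z j0 else 0) else 0, 0),
      0), ?_⟩
    rw [hfd]
    ext i
    simp [hj0]
  · intro hs
    let T : (Fin n → ℂ) →ₗ[ℂ] (Fin n → ℂ) :=
      (fderiv ℂ F (P, z)).toLinearMap ∘ₗ LinearMap.inr ℂ _ _
    have hT : Function.Surjective T := hs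
    have hTi := LinearMap.injective_iff_surjective.2 hT
    apply hz0
    apply hTi
    rw [map_zero]
    show fderiv ℂ F (P, z) (0, z) = 0
    rw [hfd]
    ext i
    simp [hz]

lemma c_ae (m n : ℕ) (hn : 1 ≤ n) : ∀ᵐ P : CPParams m n, P.2.2.1 ≠ 0 := by
  let L : CPParams m n →ₗ[ℝ] (Fin n → ℂ) :=
    LinearMap.fst ℝ _ _ ∘ₗ LinearMap.snd ℝ _ _ ∘ₗ LinearMap.snd ℝ _ _
  have := Measure.addHaar_submodule (volume : Measure (CPParams m n)) (LinearMap.ker L) (by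
    intro h
    have h1 : ((0, 0, 1, 0, 0, 0) : CPParams m n) ∈ LinearMap.ker L := by rw [h]; trivial
    have h2 : (1 : Fin n → ℂ) = 0 := h1
    exact one_ne_zero (congrFun h2 ⟨0, hn⟩))
  rw [ae_iff]
  refine measure_mono_null ?_ this
  intro P hP
  simp only [Set.mem_ofPred_eq, not_not] at hP
  exact hP

/-- **Generic nondegeneracy.** For Lebesgue-almost every parameter tuple
`(A, b, c, u, v, w)`, every complex solution of `Φ^{A,b,c,u,v,w} = 0` with `μ ≠ 0`
is nonsingular. -/
theorem generic_nondegeneracy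
    (m n : ℕ) (hn : 1 ≤ n) (hmn : n < m) :
    ∀ᵐ P : (Fin m → Fin n → ℂ) × (Fin m → ℂ) × (Fin n → ℂ) ×
        (Fin n → ℂ) × (Fin m → ℂ) × (Fin m → ℂ),
      ∀ z : CPVars ℂ m n,
        cpPhi (Matrix.of P.1) P.2.1 P.2.2.1 P.2.2.2.1 P.2.2.2.2.1 P.2.2.2.2.2 z = 0 →
        z.2.2.2.2.2.2 ≠ 0 →
        Function.Bijective
          (fderiv ℂ
            (cpPhi (Matrix.of P.1) P.2.1 P.2.2.1 P.2.2.2.1 P.2.2.2.2.1 P.2.2.2.2.2) z) := by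
  have hfr : Module.finrank ℂ (CPVars ℂ m n) = Module.finrank ℂ (CPCod m n) := by
    simp only [Module.finrank_prod, Module.finrank_fin_fun, Module.finrank_self]
    omega
  have h0 := sard_param (volume : Measure (CPParams m n)) hfr (cpF m n) (cpF_contDiff m n)
  have h1 : ∀ᵐ P : CPParams m n, P ∉ Prod.fst '' {q : CPParams m n × CPVars ℂ m n |
      cpF m n q = 0 ∧ Function.Surjective (fderiv ℂ (cpF m n) q) ∧
      ¬ Function.Surjective (fun z : CPVars ℂ m n => fderiv ℂ (cpF m n) q (0, z))} :=
    measure_eq_zero_iff_ae_notMem.1 h0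
  filter_upwards [h1, inj_ae m n hmn, c_ae m n hn] with P hP hA hc z hz hμ
  have hfd : ∀ d, fderiv ℂ
      (cpPhi (Matrix.of P.1) P.2.1 P.2.2.1 P.2.2.2.1 P.2.2.2.2.1 P.2.2.2.2.2) z d =
      fderiv ℂ (cpF m n) (P, z) (0, d) := by
    intro d
    have e1 : HasFDerivAt (cpF m n) (fderiv ℂ (cpF m n) (P, z)) (P, z) :=
      (((cpF_contDiff m n).differentiable one_ne_zero) (P, z)).hasFDerivAt
    have e2 := e1.comp z (hasFDerivAt_prodMk_right P z)
    have e3 : HasFDerivAt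
      (cpPhi (Matrix.of P.1) P.2.1 P.2.2.1 P.2.2.2.1 P.2.2.2.2.1 P.2.2.2.2.2) _ z := e2
    rw [e3.fderiv]
    rfl
  suffices hs : Function.Surjective (fderiv ℂ
      (cpPhi (Matrix.of P.1) P.2.1 P.2.2.1 P.2.2.2.1 P.2.2.2.2.1 P.2.2.2.2.2) z) from
    ⟨(LinearMap.injective_iff_surjective_of_finrank_eq_finrank
      (f := (fderiv ℂ (cpPhi (Matrix.of P.1) P.2.1 P.2.2.1 P.2.2.2.1 P.2.2.2.2.1 P.2.2.2.2.2) z :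
        CPVars ℂ m n →ₗ[ℂ] CPCod m n)) hfr).2 hs, hs⟩
  by_contra hns
  apply hP
  refine ⟨(P, z), ⟨hz, ?_, ?_⟩, rfl⟩
  · obtain ⟨A, b, c, u, v, w⟩ := P
    obtain ⟨x, s, y, dx, ds, dy, μ⟩ := z
    simp only [cpPhi, Prod.mk_eq_zero] at hz hμ hA hc
    obtain ⟨g1, g2, g3, g4, g5, g6, g7⟩ := hz
    have h3 : ∀ i, s i * y i = μ := fun i => sub_eq_zero.1 (congrFun g3 i)
    have h4 : ∀ i, ∑ j, A i j * dx j = ds i := fun i => sub_eq_zero.1 (congrFun g4 i)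
    have h6 : ∀ i, ds i * y i + s i * dy i = 1 := fun i => sub_eq_zero.1 (congrFun g6 i)
    refine cpF_surj m n (by omega) A b v w s y ds dy c u x dx μ hμ hA ?_ h3 h4 h6
    intro hdx
    apply hc
    have hds : ∀ i, ds i = 0 := fun i => by rw [← h4 i, hdx]; simp
    have hy : y = μ • dy := by
      ext i
      have a := h6 i
      rw [hds i] at a
      simp only [Pi.smul_apply, smul_eq_mul]
      linear_combination (-y i) * a + dy i * h3 i
    rw [sub_eq_zero] at g2
    rw [← g2, hy, Matrix.mulVec_smul, g5, smul_zero]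
  · intro hs
    apply hns
    intro w
    obtain ⟨d, hd⟩ := hs w
    exact ⟨d, by rw [hfd]; exact hd⟩
end

section
/- Let m > n ≥ 1, let A be a complex m×n matrix, b ∈ ℂ^m, c ∈ ℂ^n, u ∈ ℂ^n, v, w ∈ ℂ^m, and set û = u + Aᵀv. Define Ψ : ℂ^{2n+4m+1} → ℂ^{2n+4m+1} by Ψ(x,s,y,ẋ,ṡ,ẏ,μ) = (Ax − s − b, Aᵀy − c, s∘y − μe, Aẋ − ṡ, Aᵀẏ, μẏ + y∘y∘ṡ − y, ûᵀẋ + wᵀẏ). Then for every z = (x,s,y,ẋ,ṡ,ẏ,μ) with μ ≠ 0, one has Φ^{A,b,c,u,v,w}(z) = 0 if and only if Ψ(z) = 0. -/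
/-- The simplified polynomial map `Ψ`, with sixth component `μẏ + y∘y∘ṡ − y` and
seventh component `ûᵀẋ + wᵀẏ` where `û = u + Aᵀv`. -/
noncomputable def cpPsi {m n : ℕ} (A : Matrix (Fin m) (Fin n) ℂ)
    (b : Fin m → ℂ) (c : Fin n → ℂ) (u : Fin n → ℂ) (v w : Fin m → ℂ)
    (z : CPVars ℂ m n) :
    (Fin m → ℂ) × (Fin n → ℂ) × (Fin m → ℂ) × (Fin m → ℂ) × (Fin n → ℂ) × (Fin m → ℂ) × ℂ :=
  (A.mulVec z.1 - z.2.1 - b,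
   A.transpose.mulVec z.2.2.1 - c,
   (fun i => z.2.1 i * z.2.2.1 i - z.2.2.2.2.2.2),
   A.mulVec z.2.2.2.1 - z.2.2.2.2.1,
   A.transpose.mulVec z.2.2.2.2.2.1,
   (fun i => z.2.2.2.2.2.2 * z.2.2.2.2.2.1 i + z.2.2.1 i * z.2.2.1 i * z.2.2.2.2.1 i
     - z.2.2.1 i),
   (∑ j, (u + A.transpose.mulVec v) j * z.2.2.2.1 j) + (∑ i, w i * z.2.2.2.2.2.1 i))

/-- **Equivalence of `Φ` and the simplified system `Ψ` away from `μ = 0`.** -/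
theorem phi_eq_zero_iff_psi_eq_zero
    (m n : ℕ) (hn : 1 ≤ n) (hmn : n < m)
    (A : Matrix (Fin m) (Fin n) ℂ)
    (b : Fin m → ℂ) (c : Fin n → ℂ) (u : Fin n → ℂ) (v w : Fin m → ℂ)
    (z : CPVars ℂ m n) (hμ : z.2.2.2.2.2.2 ≠ 0) :
    cpPhi A b c u v w z = 0 ↔ cpPsi A b c u v w z = 0 := by
  obtain ⟨x, s, y, dx, ds, dy, μ⟩ := z
  simp only at hμ
  simp only [cpPhi, cpPsi, Prod.mk_eq_zero]
  refine and_congr_right fun _ => and_congr_right fun _ => and_congr_right fun h3 =>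
    and_congr_right fun h4 => and_congr_right fun _ => and_congr ?_ ?_
  · rw [funext_iff, funext_iff]
    refine forall_congr' fun i => ?_
    have h := congrFun h3 i
    simp only [Pi.zero_apply] at h ⊢
    have hy : y i ≠ 0 := by
      intro h0
      apply hμ
      rw [h0] at h
      linear_combination -h
    have key : μ * dy i + y i * y i * ds i - y i
        = y i * (ds i * y i + s i * dy i - 1) := by
      linear_combination (-dy i) * h
    rw [key, mul_eq_zero]
    simp [hy]
  · have hs : ds = A.mulVec dx := (sub_eq_zero.mp h4).symm
    have key : (∑ j, (u + A.transpose.mulVec v) j * dx j)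
        = (∑ j, u j * dx j) + ∑ i, v i * ds i := by
      change (u + A.transpose.mulVec v) ⬝ᵥ dx = u ⬝ᵥ dx + v ⬝ᵥ ds
      rw [add_dotProduct, hs, Matrix.mulVec_transpose, Matrix.dotProduct_mulVec]
    rw [key]
end
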